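/- arXiv:1709.10031 — 2 statements merged into one kernel-verified Lean document; each statement's English description precedes it below -/
import Mathlib

section
/- Let G be a finite group and let W be an abelian normal subgroup of G with quotient D = G/W, so that D acts naturally on W by conjugation. Suppose that there exists a normal subgroup H of D such that gcd(#H, #W) = 1 and such that no non-identity element of W is fixed under the action of H on W. Then the extension 1 → W → G → D → 1 splits, i.e. there exists a subgroup of G that is a complement to W, so G ≅ W⋊D. -/
/-- Conjugacy part of Schur-Zassenhaus for an abelian normal subgroup, by averaging. -/
theorem conj_aux {G : Type*} [Group G] [Finite G] (W : Subgroup G) [W.Normal]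
    (hWab : ∀ a ∈ W, ∀ b ∈ W, a * b = b * a) (K K' : Subgroup G)
    (hcop : Nat.Coprime (Nat.card K) (Nat.card W))
    (hdis : ∀ x ∈ W, x ∈ K' → x = 1)
    (hex : ∀ k ∈ K, ∃ x ∈ K', x * k⁻¹ ∈ W) :
    ∃ w ∈ W, ∀ k ∈ K, w * k * w⁻¹ ∈ K' := by
  classical
  have hWn : W.Normal := inferInstance
  letI : CommGroup W := { (inferInstance : Group W) with
    mul_comm := fun a b => Subtype.ext (hWab a a.2 b b.2) }
  letI := Fintype.ofFinite K
  have hex' : ∀ k : K, ∃ x : G, x ∈ K' ∧ x * (k : G)⁻¹ ∈ W := fun k => by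
    obtain ⟨x, h1, h2⟩ := hex k k.2
    exact ⟨x, h1, h2⟩
  choose φ hφ hφW using hex'
  have hmul : ∀ k l : K, φ (k * l) = φ k * φ l := by
    intro k l
    have h : φ (k * l) * (φ k * φ l)⁻¹ = 1 := by
      apply hdis
      · have h1 := hφW (k * l)
        have h2 := W.inv_mem (hφW k)
        have h3 := hWn.conj_mem _ (W.inv_mem (hφW l)) k
        have := W.mul_mem (W.mul_mem h1 h3) h2
        convert this using 1
        push_cast
        group
      · exact K'.mul_mem (hφ _) (K'.inv_mem (K'.mul_mem (hφ _) (hφ _)))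
    exact mul_inv_eq_one.mp h
  let f : K → W := fun k => ⟨φ k * (k : G)⁻¹, hφW k⟩
  let c : K → W →* W := fun k =>
    { toFun := fun w => ⟨k * w * (k : G)⁻¹, hWn.conj_mem _ w.2 k⟩
      map_one' := by ext; simp
      map_mul' := fun a b => by ext; simp }
  have hf : ∀ k l, f (k * l) = f k * c k (f l) := by
    intro k l
    ext
    simp only [f, c, hmul, Subgroup.coe_mul, MonoidHom.coe_mk, OneHom.coe_mk]
    group
  have hu : ∀ k, (∏ l, f l) = f k ^ (Nat.card K) * c k (∏ l, f l) := by
    intro k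
    calc (∏ l, f l) = ∏ l, f (k * l) := (Equiv.prod_comp (Equiv.mulLeft k) f).symm
      _ = _ := by
        simp_rw [hf, Finset.prod_mul_distrib, map_prod]
        simp
  obtain ⟨v, hv⟩ := (powCoprime (G := W) hcop.symm).surjective (∏ l, f l)
  have hv' : v ^ Nat.card K = ∏ l, f l := hv
  refine ⟨v, v.2, fun k hk => ?_⟩
  have h1 : v = f ⟨k, hk⟩ * c ⟨k, hk⟩ v := by
    apply (powCoprime (G := W) hcop.symm).injective
    change v ^ Nat.card K = (f ⟨k, hk⟩ * c ⟨k, hk⟩ v) ^ Nat.card K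
    rw [mul_pow, ← map_pow, hv']
    exact hu _
  have h2 : (v : G) = φ ⟨k, hk⟩ * k⁻¹ * (k * v * k⁻¹) := congrArg Subtype.val h1
  have h3 : (v : G) * k * (v : G)⁻¹ = φ ⟨k, hk⟩ := by
    rw [mul_inv_eq_iff_eq_mul, ← eq_mul_inv_iff_mul_eq]
    calc (v : G) = _ := h2
      _ = _ := by group
  rw [h3]
  exact hφ _

/-- if `W` is an abelian normal subgroup of the finite group `G`, and
there is a normal subgroup `H` of `D = G/W` of order coprime to `#W` such that no
non-identity element of `W` is fixed by the conjugation action of `H`, then the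
extension `1 → W → G → D → 1` splits, i.e. `W` has a complement in `G`. -/
theorem ses_splits (G : Type*) [Group G] [Finite G] (W : Subgroup G) [W.Normal]
    (hWab : ∀ a ∈ W, ∀ b ∈ W, a * b = b * a)
    (H : Subgroup (G ⧸ W)) (hHnorm : H.Normal)
    (hcop : Nat.Coprime (Nat.card H) (Nat.card W))
    (hfix : ∀ w ∈ W,
      (∀ g : G, (QuotientGroup.mk g : G ⧸ W) ∈ H → g * w * g⁻¹ = w) → w = 1) :
    ∃ D : Subgroup G, W ⊓ D = ⊥ ∧ W ⊔ D = ⊤ := by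
  classical
  have hWn : W.Normal := inferInstance
  let N : Subgroup G := H.comap (QuotientGroup.mk' W)
  have hWN : W ≤ N := by
    intro w hw
    change (QuotientGroup.mk w : G ⧸ W) ∈ H
    rw [(QuotientGroup.eq_one_iff w).mpr hw]
    exact H.one_mem
  have hNn : N.Normal := hHnorm.comap _
  have hcW : Nat.card (W.subgroupOf N) = Nat.card W :=
    Nat.card_congr (Subgroup.subgroupOfEquivOfLe hWN).toEquiv
  have hidx : (W.subgroupOf N).index = Nat.card H := by
    have := Subgroup.relIndex_ker N (QuotientGroup.mk' W)
    rw [QuotientGroup.ker_mk', Subgroup.map_comap_eq_self_of_surjective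
      (QuotientGroup.mk'_surjective W)] at this
    exact this
  obtain ⟨K0, hK0⟩ := Subgroup.exists_right_complement'_of_coprime
    (N := W.subgroupOf N) (by rw [hcW, hidx]; exact hcop.symm)
  let K : Subgroup G := K0.map N.subtype
  have hcK : Nat.card K = Nat.card H := by
    rw [← hidx, hK0.symm.index_eq_card]
    exact Nat.card_congr (K0.equivMapOfInjective _ N.subtype_injective).symm.toEquiv
  have hKN : K ≤ N := Subgroup.map_subtype_le K0
  have hdis : ∀ x ∈ W, x ∈ K → x = 1 := by
    rintro x hx ⟨y, hy, rfl⟩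
    have := Subgroup.disjoint_def.mp hK0.disjoint (x := y) hx hy
    simp [this]
  have hfac : ∀ n ∈ N, ∃ w ∈ W, ∃ k ∈ K, n = w * k := by
    intro n hn
    obtain ⟨⟨a, b⟩, hab⟩ := hK0.2 ⟨n, hn⟩
    exact ⟨a.1, a.2, b.1, ⟨b.1, b.2, rfl⟩, (congrArg Subtype.val hab).symm⟩
  have hmemn : ∀ d : G, (∀ k ∈ K, d * k * d⁻¹ ∈ K) → d ∈ Subgroup.normalizer (K : Set G) := by
    intro d hd
    have hle : K.map (MulAut.conj d).toMonoidHom ≤ K := by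
      rintro _ ⟨k, hk, rfl⟩
      exact hd k hk
    have heq : K.map (MulAut.conj d).toMonoidHom = K := by
      apply Subgroup.eq_of_le_of_card_ge hle
      exact (Nat.card_congr (K.equivMapOfInjective (MulAut.conj d).toMonoidHom
        (MulAut.conj d).injective).toEquiv).le
    rw [Subgroup.mem_normalizer_iff]
    intro h
    refine ⟨hd h, fun hh => ?_⟩
    rw [← heq] at hh
    obtain ⟨k, hk, hkk⟩ := hh
    have : k = h := (MulAut.conj d).injective hkk
    exact this ▸ hk
  refine ⟨Subgroup.normalizer (K : Set G), ?_, ?_⟩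
  · rw [eq_bot_iff]
    rintro w ⟨hw, hwn⟩
    rw [Subgroup.mem_bot]
    have hwn' := Subgroup.mem_normalizer_iff.mp hwn
    apply hfix w hw
    intro g hg
    obtain ⟨v, hv, k, hk, rfl⟩ := hfac g hg
    have hck : w * k * w⁻¹ * k⁻¹ = 1 := by
      apply hdis
      · have := W.mul_mem hw (hWn.conj_mem _ (W.inv_mem hw) k)
        simpa [mul_assoc] using this
      · exact K.mul_mem ((hwn' k).mp hk) (K.inv_mem hk)
    have hck' : w * k = k * w := by
      rw [mul_inv_eq_one, mul_inv_eq_iff_eq_mul] at hck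
      exact hck
    rw [mul_inv_eq_iff_eq_mul, mul_assoc, ← hck', ← mul_assoc, hWab v hv w hw, mul_assoc]
  · rw [eq_top_iff]
    intro g _
    obtain ⟨w, hw, hwk⟩ := conj_aux W hWab K (K.map (MulAut.conj g).toMonoidHom)
      (by rw [hcK]; exact hcop)
      (by
        rintro _ hx ⟨y, hy, rfl⟩
        have hx' : g * y * g⁻¹ ∈ W := hx
        have : y = 1 := hdis y (by simpa [mul_assoc] using hWn.conj_mem _ hx' g⁻¹) hy
        simp [this])
      (by
        intro k hk
        obtain ⟨v, hv, l, hl, hvl⟩ := hfac (g⁻¹ * k * g)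
          (by simpa using hNn.conj_mem _ (hKN hk) g⁻¹)
        refine ⟨g * l * g⁻¹, ⟨l, hl, rfl⟩, ?_⟩
        have hl' : l = v⁻¹ * (g⁻¹ * k * g) := by rw [hvl]; group
        have := hWn.conj_mem _ (W.inv_mem hv) g
        convert this using 1
        rw [hl']
        group)
    have hd : g⁻¹ * w ∈ Subgroup.normalizer (K : Set G) := by
      apply hmemn
      intro k hk
      obtain ⟨l, hl, hlk⟩ := hwk k hk
      have hlk' : g * l * g⁻¹ = w * k * w⁻¹ := hlk
      have : g⁻¹ * w * k * (g⁻¹ * w)⁻¹ = l := by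
        calc _ = g⁻¹ * (w * k * w⁻¹) * g := by group
          _ = l := by rw [← hlk']; group
      rw [this]
      exact hl
    have : g = w * (g⁻¹ * w)⁻¹ := by group
    rw [this]
    exact Subgroup.mul_mem_sup hw (Subgroup.inv_mem _ hd)
end

section
/- Let G be a finite group, l a prime, and 𝒦 a field of characteristic l. Suppose that there exists a normal subgroup N of G such that l does not divide #N and G/N is a cyclic l-group. Then for every finite-dimensional 𝒦[G]-module M, the dimensions over 𝒦 of the invariants M^G and of the coinvariants M_G are equal. Moreover, if M is indecomposable, then this common dimension is 0 or 1. -/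
/-- Linear algebra core: an indecomposable nilpotent endomorphism has kernel of dimension at most 1. -/
theorem finrank_ker_le_one_of_nilpotent {K M : Type*} [Field K] [AddCommGroup M] [Module K M]
    [FiniteDimensional K M] [Nontrivial M] (U : Module.End K M) (hU : IsNilpotent U)
    (h : ∀ N₁ N₂ : Submodule K M, (∀ x ∈ N₁, U x ∈ N₁) → (∀ x ∈ N₂, U x ∈ N₂) →
      N₁ ⊓ N₂ = ⊥ → N₁ ⊔ N₂ = ⊤ → N₁ = ⊥ ∨ N₂ = ⊥) :
    Module.finrank K (LinearMap.ker U) ≤ 1 := by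
  obtain ⟨k, hk⟩ : ∃ k, nilpotencyClass U = k + 1 :=
    Nat.exists_eq_succ_of_ne_zero (pos_nilpotencyClass_iff.mpr hU).ne'
  have hz : U ^ (k + 1) = 0 := hk ▸ pow_nilpotencyClass hU
  have hnz : U ^ k ≠ 0 := by
    have := pow_pred_nilpotencyClass hU
    rwa [hk] at this
  obtain ⟨v, hv⟩ : ∃ v, (U ^ k) v ≠ 0 := by
    by_contra! hc
    exact hnz (LinearMap.ext hc)
  obtain ⟨φ, hφ⟩ : ∃ φ : Module.Dual K M, φ ((U ^ k) v) ≠ 0 := by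
    by_contra! hc
    exact hv ((Module.forall_dual_apply_eq_zero_iff K _).mp hc)
  have hzero : ∀ i, k < i → ∀ x, (U ^ i) x = 0 := by
    intro i hi x
    rw [pow_eq_zero_of_le hi hz]; rfl
  let Φ : M →ₗ[K] (Fin (k + 1) → K) := LinearMap.pi fun i => φ ∘ₗ (U ^ (i : ℕ))
  let Ψ : (Fin (k + 1) → K) →ₗ[K] M := Fintype.linearCombination K fun i => (U ^ (i : ℕ)) v
  have hΦ : ∀ x i, Φ x i = φ ((U ^ (i : ℕ)) x) := fun x i => rfl
  have hΨ : ∀ c, Ψ c = ∑ i, c i • (U ^ (i : ℕ)) v := fun c => rfl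
  have hΨmem : ∀ i, (U ^ i) v ∈ LinearMap.range Ψ := by
    intro i
    by_cases hi : i < k + 1
    · refine ⟨Pi.single ⟨i, hi⟩ 1, ?_⟩
      rw [hΨ, Finset.sum_eq_single ⟨i, hi⟩]
      · simp
      · intro b _ hb; simp [hb]
      · simp
    · rw [hzero i (by omega)]; exact zero_mem _
  have hinj : Function.Injective (Φ ∘ₗ Ψ) := by
    rw [injective_iff_map_eq_zero]
    intro c hc
    have key : ∀ m : ℕ, ∀ hm : m < k + 1, c ⟨m, hm⟩ = 0 := by
      intro m
      induction m using Nat.strong_induction_on with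
      | _ m ih =>
        intro hm
        have h1 : Φ (Ψ c) ⟨k - m, by omega⟩ = 0 := by
          have := congrFun hc ⟨k - m, by omega⟩
          exact this
        rw [hΦ, hΨ, map_sum, map_sum, Finset.sum_eq_single ⟨m, hm⟩] at h1
        · rw [map_smul, map_smul, ← Module.End.mul_apply, ← pow_add] at h1
          simp only [] at h1
          rw [Nat.sub_add_cancel (by omega)] at h1
          simpa [hφ] using h1
        · intro b _ hb
          have hb' : (b : ℕ) ≠ m := fun hh => hb (Fin.ext hh)
          rcases lt_or_gt_of_ne hb' with hlt | hgt
          · have := ih b hlt b.2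
            have h2 : c b = 0 := this
            rw [h2]; simp
          · rw [map_smul, ← Module.End.mul_apply, ← pow_add,
              hzero _ (by simp only []; omega)]
            simp
        · simp
    ext i
    exact key i i.2
  have hsurj : Function.Surjective (Φ ∘ₗ Ψ) := LinearMap.injective_iff_surjective.mp hinj
  have hcases := h (LinearMap.range Ψ) (LinearMap.ker Φ) ?_ ?_ ?_ ?_
  · rcases hcases with h1 | h1
    · exfalso
      have := hΨmem k
      rw [h1] at this
      exact hv ((Submodule.mem_bot K).mp this)
    · have hi : Function.Injective (φ ∘ₗ (LinearMap.ker U).subtype) := by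
        rw [injective_iff_map_eq_zero]
        rintro ⟨x, hx⟩ hx0
        have hx0' : φ x = 0 := hx0
        have : x ∈ LinearMap.ker Φ := by
          rw [LinearMap.mem_ker]
          ext i
          rw [hΦ]
          rcases hi : (i : ℕ) with _ | j
          · simpa using hx0'
          · rw [pow_succ, Module.End.mul_apply, LinearMap.mem_ker.mp hx]; simp
        rw [h1] at this
        exact Subtype.ext ((Submodule.mem_bot K).mp this)
      have := LinearMap.finrank_le_finrank_of_injective hi
      simpa using this
  · rintro x ⟨c, rfl⟩
    rw [hΨ, map_sum]
    refine Submodule.sum_mem _ fun i _ => ?_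
    rw [map_smul, ← Module.End.mul_apply, ← pow_succ']
    exact Submodule.smul_mem _ _ (hΨmem _)
  · intro x hx
    rw [LinearMap.mem_ker] at hx ⊢
    ext i
    rw [hΦ, ← Module.End.mul_apply, ← pow_succ]
    by_cases hi : (i : ℕ) + 1 < k + 1
    · exact congrFun hx ⟨i + 1, hi⟩
    · rw [hzero _ (by omega)]; simp
  · rw [eq_bot_iff]
    rintro x ⟨⟨c, rfl⟩, hx⟩
    have : c = 0 := hinj (by rw [map_zero]; exact hx)
    simp [this]
  · rw [eq_top_iff]
    intro x _
    obtain ⟨c, hc⟩ := hsurj (Φ x)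
    rw [Submodule.mem_sup]
    refine ⟨Ψ c, ⟨c, rfl⟩, x - Ψ c, ?_, by abel⟩
    rw [LinearMap.mem_ker, map_sub, sub_eq_zero]
    exact hc.symm

/-- let `l` be a prime, `𝒦` a field of characteristic `l`, and `G` a
finite group with a normal subgroup `N` of order prime to `l` such that `G/N` is a
cyclic `l`-group. Then for every finite-dimensional `𝒦[G]`-module `M` the invariants
and the coinvariants have the same dimension; moreover, if `M` is indecomposable, this
common dimension is `0` or `1`. -/
theorem invariants_dim_eq_coinvariants_dim (l : ℕ) (hl : l.Prime)
    (𝒦 : Type*) [Field 𝒦] [CharP 𝒦 l] (G : Type*) [Group G] [Finite G]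
    (N : Subgroup G) [N.Normal] (hNcard : ¬ l ∣ Nat.card N)
    (hcyc : IsCyclic (G ⧸ N)) (hlgroup : IsPGroup l (G ⧸ N))
    (M : Type*) [AddCommGroup M] [Module 𝒦 M] [FiniteDimensional 𝒦 M]
    (ρ : Representation 𝒦 G M) :
    Module.finrank 𝒦 ρ.invariants =
        Module.finrank 𝒦
          (M ⧸ Submodule.span 𝒦 {x : M | ∃ (g : G) (m : M), x = ρ g m - m}) ∧
      (((∃ m : M, m ≠ 0) ∧
          ∀ N₁ N₂ : Submodule 𝒦 M, (∀ g : G, ∀ x ∈ N₁, ρ g x ∈ N₁) →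
            (∀ g : G, ∀ x ∈ N₂, ρ g x ∈ N₂) → N₁ ⊓ N₂ = ⊥ → N₁ ⊔ N₂ = ⊤ →
            N₁ = ⊥ ∨ N₂ = ⊥) →
        Module.finrank 𝒦 ρ.invariants = 0 ∨ Module.finrank 𝒦 ρ.invariants = 1) := by
  classical
  have := Fact.mk hl
  -- a lift of a generator
  obtain ⟨q, hq⟩ := hcyc.exists_generator
  obtain ⟨g₀, rfl⟩ := QuotientGroup.mk_surjective q
  have hdec : ∀ g : G, ∃ k : ℕ, ∃ n ∈ N, g = g₀ ^ k * n := by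
    intro g
    have h1 : (g : G ⧸ N) ∈ Submonoid.powers (g₀ : G ⧸ N) :=
      mem_powers_iff_mem_zpowers.mpr (hq g)
    obtain ⟨k, hk⟩ := h1
    refine ⟨k, (g₀ ^ k)⁻¹ * g, ?_, by group⟩
    rw [← QuotientGroup.eq]
    simpa using hk
  have : Fintype N := Fintype.ofFinite N
  have hc : (Fintype.card N : 𝒦) ≠ 0 := by
    rw [Ne, CharP.cast_eq_zero_iff 𝒦 l, ← Nat.card_eq_fintype_card]; exact hNcard
  -- the averaging idempotent
  let e : Module.End 𝒦 M := (Fintype.card N : 𝒦)⁻¹ • ∑ n : N, ρ n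
  have he : ∀ x, e x = (Fintype.card N : 𝒦)⁻¹ • ∑ n : N, ρ n x := by
    intro x; simp [e]
  have he_fix : ∀ x, (∀ n ∈ N, ρ n x = x) → e x = x := by
    intro x hx
    rw [he, Finset.sum_congr rfl (fun (n : N) _ => hx n n.2)]
    simp only [Finset.sum_const, Finset.card_univ]
    rw [← Nat.cast_smul_eq_nsmul 𝒦, smul_smul, inv_mul_cancel₀ hc, one_smul]
  have hne : ∀ n ∈ N, ∀ x, ρ n (e x) = e x := by
    intro n hn x
    rw [he, map_smul, map_sum]
    congr 1
    refine Fintype.sum_equiv (Equiv.mulLeft (⟨n, hn⟩ : N)) _ _ fun m => ?_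
    simp
  have hen : ∀ n ∈ N, ∀ x, e (ρ n x) = e x := by
    intro n hn x
    rw [he, he]
    congr 1
    refine Fintype.sum_equiv (Equiv.mulRight (⟨n, hn⟩ : N)) _ _ fun m => ?_
    simp
  have hee : ∀ x, e (e x) = e x := fun x => he_fix _ fun n hn => hne n hn x
  have heg : ∀ g x, e (ρ g x) = ρ g (e x) := by
    intro g x
    rw [he, he, map_smul, map_sum]
    congr 1
    refine Fintype.sum_equiv (MulAut.conjNormal (g⁻¹) : MulAut N).toEquiv _ _ fun m => ?_
    have : ((MulAut.conjNormal (g⁻¹) : MulAut N) m : G) = g⁻¹ * m * g := by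
      rw [MulAut.conjNormal_apply]; simp
    change _ = ρ g (ρ ((MulAut.conjNormal (g⁻¹) : MulAut N) m : G) x)
    rw [this, ← Module.End.mul_apply, ← Module.End.mul_apply, ← map_mul, ← map_mul]
    congr 2
    group
  let A : Module.End 𝒦 M := (ρ g₀ - 1) * e + (1 - e)
  have hA : ∀ x, A x = ρ g₀ (e x) - e x + (x - e x) := fun x => rfl
  have hker : LinearMap.ker A = ρ.invariants := by
    ext x
    rw [LinearMap.mem_ker, Representation.mem_invariants]
    constructor
    · intro hx
      rw [hA] at hx
      have h1 := congrArg e hx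
      simp only [map_add, map_sub, heg, hee, map_zero, sub_self, add_zero] at h1
      rw [h1, zero_add, sub_eq_zero] at hx
      rw [← hx, sub_eq_zero] at h1
      have hN : ∀ n ∈ N, ρ n x = x := by
        intro n hn
        have := hne n hn x
        rwa [← hx] at this
      intro g
      obtain ⟨k, n, hn, rfl⟩ := hdec g
      rw [map_mul, Module.End.mul_apply, hN n hn]
      clear hn
      have h1' : ρ g₀ x = x := h1
      induction k with
      | zero => simp
      | succ k ih => rw [pow_succ, map_mul, Module.End.mul_apply, h1', ih]
    · intro hx
      rw [hA, he_fix x (fun n _ => hx n), hx]; simp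
  have hrange : LinearMap.range A =
      Submodule.span 𝒦 {x : M | ∃ (g : G) (m : M), x = ρ g m - m} := by
    apply le_antisymm
    · rintro _ ⟨x, rfl⟩
      rw [hA]
      refine add_mem (Submodule.subset_span ⟨g₀, _, rfl⟩) ?_
      have : x - e x = -((Fintype.card N : 𝒦)⁻¹ • ∑ n : N, (ρ n x - x)) := by
        rw [Finset.sum_sub_distrib, smul_sub, ← he]
        simp only [Finset.sum_const, Finset.card_univ]
        rw [← Nat.cast_smul_eq_nsmul 𝒦, smul_smul, inv_mul_cancel₀ hc, one_smul]
        abel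
      rw [this]
      exact neg_mem (Submodule.smul_mem _ _ (Submodule.sum_mem _ fun n _ =>
        Submodule.subset_span ⟨n, x, rfl⟩))
    · rw [Submodule.span_le]
      have hr1 : ∀ x, x - e x ∈ LinearMap.range A := fun x =>
        ⟨x - e x, by rw [hA]; simp [hee]⟩
      have hr2 : ∀ x, ρ g₀ (e x) - e x ∈ LinearMap.range A := fun x =>
        ⟨e x, by rw [hA]; simp [hee]⟩
      have hrN : ∀ n ∈ N, ∀ x, ρ n x - x ∈ LinearMap.range A := by
        intro n hn x
        have := sub_mem (hr1 (ρ n x)) (hr1 x)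
        rw [hen n hn] at this
        simpa using this
      have hr0 : ∀ x, ρ g₀ x - x ∈ LinearMap.range A := by
        intro x
        have := add_mem (sub_mem (hr1 (ρ g₀ x)) (hr1 x)) (hr2 x)
        rw [heg] at this
        convert this using 1
        abel
      rintro _ ⟨g, m, rfl⟩
      obtain ⟨k, n, hn, rfl⟩ := hdec g
      have hk : ∀ (k : ℕ) (y : M), ρ (g₀ ^ k) y - y ∈ LinearMap.range A := by
        intro k
        induction k with
        | zero => intro y; simp
        | succ k ih =>
          intro y
          have := add_mem (ih (ρ g₀ y)) (hr0 y)
          rw [sub_add_sub_cancel] at this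
          rwa [pow_succ, map_mul, Module.End.mul_apply]
      have := add_mem (hk k (ρ n m)) (hrN n hn m)
      rw [sub_add_sub_cancel] at this
      rw [map_mul, Module.End.mul_apply]
      exact this
  refine ⟨?_, ?_⟩
  · rw [← hker, ← hrange]
    have h1 := LinearMap.finrank_range_add_finrank_ker A
    have h2 := Submodule.finrank_quotient_add_finrank (LinearMap.range A)
    omega
  · rintro ⟨⟨m₀, hm₀⟩, hind⟩
    have : Nontrivial M := ⟨m₀, 0, hm₀⟩
    have hcase : LinearMap.range e = ⊥ ∨ LinearMap.ker e = ⊥ := by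
      refine hind (LinearMap.range e) (LinearMap.ker e) ?_ ?_ ?_ ?_
      · rintro g _ ⟨x, rfl⟩
        exact ⟨ρ g x, heg g x⟩
      · intro g x hx
        rw [LinearMap.mem_ker] at hx ⊢
        rw [heg, hx, map_zero]
      · rw [eq_bot_iff]
        rintro _ ⟨⟨x, rfl⟩, hx⟩
        have hx' : e (e x) = 0 := hx
        rw [hee] at hx'
        exact hx'
      · rw [eq_top_iff]
        intro x _
        rw [Submodule.mem_sup]
        refine ⟨e x, ⟨x, rfl⟩, x - e x, ?_, by abel⟩
        simp [LinearMap.mem_ker, hee]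
    rcases hcase with hV | hW
    · left
      have : ρ.invariants = ⊥ := by
        rw [eq_bot_iff, ← hV]
        intro x hx
        exact ⟨x, he_fix x fun n _ => hx n⟩
      rw [this]; simp
    · have he1 : ∀ x, e x = x := by
        intro x
        have : x - e x ∈ LinearMap.ker e := by simp [LinearMap.mem_ker, hee]
        rw [hW, Submodule.mem_bot, sub_eq_zero] at this
        exact this.symm
      have hN : ∀ n ∈ N, ∀ x, ρ n x = x := by
        intro n hn x
        have := hne n hn x
        rwa [he1] at this
      have hAU : A = ρ g₀ - 1 := by
        ext x
        rw [hA, he1]; simp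
      have hnil : IsNilpotent (ρ g₀ - 1) := by
        obtain ⟨k, hk⟩ := hlgroup (g₀ : G ⧸ N)
        have : CharP (Module.End 𝒦 M) l :=
          charP_of_injective_algebraMap (FaithfulSMul.algebraMap_injective 𝒦 _) l
        refine ⟨l ^ k, ?_⟩
        rw [sub_pow_char_pow_of_commute _ _ (Commute.one_right _), one_pow, ← map_pow, sub_eq_zero]
        ext x
        apply hN
        rw [← QuotientGroup.eq_one_iff]
        simpa using hk
      have hle := finrank_ker_le_one_of_nilpotent (ρ g₀ - 1) hnil ?_
      · rw [← hAU, hker] at hle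
        omega
      · have hstab : ∀ P : Submodule 𝒦 M, (∀ x ∈ P, (ρ g₀ - 1 : Module.End 𝒦 M) x ∈ P) →
            ∀ g : G, ∀ x ∈ P, ρ g x ∈ P := by
          intro P hP g x hx
          obtain ⟨k, n, hn, rfl⟩ := hdec g
          rw [map_mul, Module.End.mul_apply, hN n hn]
          clear hn
          induction k with
          | zero => simpa using hx
          | succ k ih =>
            rw [pow_succ', map_mul, Module.End.mul_apply]
            have := add_mem (hP _ ih) ih
            simpa using this
        intro N₁ N₂ h₁ h₂
        exact hind N₁ N₂ (hstab N₁ h₁) (hstab N₂ h₂)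
end
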